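/- arXiv:2011.00498 — 4 statements merged into one kernel-verified Lean document; each statement's English description precedes it below -/
import Mathlib

section
/- Define v₁, v₂ : ℝ × ℝ → ℝ by v₁(s₁,s₂) = sin(s₁+s₂) + 2(s₁+s₂) and v₂(s₁,s₂) = sin(s₁+s₂+π) + 2(s₁+s₂). Then for every b₁ ∈ [0, 2π] there exists b₂ ∈ [0, 2π] such that v₂(b₁,b₂) > v₁(b₁,b₂) and v₂(2π, 2π) − v₂(b₁,b₂) ≥ π − 1. (Note v₂(2π,2π) = 8π.) -/
noncomputable def v₁ (s₁ s₂ : ℝ) : ℝ := Real.sin (s₁ + s₂) + 2 * (s₁ + s₂)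
noncomputable def v₂ (s₁ s₂ : ℝ) : ℝ := Real.sin (s₁ + s₂ + Real.pi) + 2 * (s₁ + s₂)

theorem v₂_eq (s₁ s₂ : ℝ) : v₂ s₁ s₂ = -Real.sin (s₁ + s₂) + 2 * (s₁ + s₂) := by
  rw [v₂, Real.sin_add_pi]

theorem v₂_two_pi_two_pi : v₂ (2 * Real.pi) (2 * Real.pi) = 8 * Real.pi := by
  rw [v₂_eq, Real.sin_add_two_pi, Real.sin_two_pi]
  ring

theorem sin_three_pi_div_two : Real.sin (3 * Real.pi / 2) = -1 := by
  rw [show 3 * Real.pi / 2 = Real.pi / 2 + Real.pi by ring, Real.sin_add_pi, Real.sin_pi_div_two]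

theorem sin_seven_pi_div_two : Real.sin (7 * Real.pi / 2) = -1 := by
  rw [show 7 * Real.pi / 2 = 3 * Real.pi / 2 + 2 * Real.pi by ring, Real.sin_add_two_pi,
    sin_three_pi_div_two]

/-- Bidder 2 gains by any bid that brings the reported sum to a point, at most `7π/2`,
where the sine is `-1`. -/
theorem profitable_of_sin_eq_neg_one {b₁ b₂ : ℝ} (hsin : Real.sin (b₁ + b₂) = -1)
    (hle : b₁ + b₂ ≤ 7 * Real.pi / 2) :
    v₂ b₁ b₂ > v₁ b₁ b₂ ∧
      v₂ (2 * Real.pi) (2 * Real.pi) - v₂ b₁ b₂ ≥ Real.pi - 1 := by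
  rw [v₂_two_pi_two_pi, v₂_eq, v₁, hsin]
  constructor <;> linarith

theorem stmt_1 :
    ∀ b₁ ∈ Set.Icc (0 : ℝ) (2 * Real.pi), ∃ b₂ ∈ Set.Icc (0 : ℝ) (2 * Real.pi),
      v₂ b₁ b₂ > v₁ b₁ b₂ ∧
      v₂ (2 * Real.pi) (2 * Real.pi) - v₂ b₁ b₂ ≥ Real.pi - 1 := by
  rintro b₁ ⟨h0, h2⟩
  have hpi := Real.pi_pos
  rcases le_total b₁ (3 * Real.pi / 2) with h | h
  · refine ⟨3 * Real.pi / 2 - b₁, ⟨by linarith, by linarith⟩,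
      profitable_of_sin_eq_neg_one ?_ (by linarith)⟩
    rw [add_sub_cancel, sin_three_pi_div_two]
  · refine ⟨7 * Real.pi / 2 - b₁, ⟨by linarith, by linarith⟩,
      profitable_of_sin_eq_neg_one ?_ (by linarith)⟩
    rw [add_sub_cancel, sin_seven_pi_div_two]
end

section
/- Define v₁, v₂ : ℝ × ℝ → ℝ by v₁(s₁,s₂) = sin(s₁+s₂) + 2(s₁+s₂) and v₂(s₁,s₂) = sin(s₁+s₂+π) + 2(s₁+s₂). Then for every b₂ ∈ [0, 2π] there exists b₁ ∈ [0, 2π] such that v₁(b₁,b₂) > v₂(b₁,b₂) and v₁(2π, 2π) − v₁(b₁,b₂) ≥ π − 1. (Note v₁(2π,2π) = 8π.) -/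
/-- If the sine equals one at `t` and `2 * t ≤ 7 * π`, then the bid `t - b₂` is a profitable
deviation against `b₂`. -/
theorem deviation_of_sin_eq_one {t b₂ : ℝ} (ht : Real.sin t = 1) (hle : 2 * t ≤ 7 * Real.pi) :
    v₁ (t - b₂) b₂ > v₂ (t - b₂) b₂ ∧
      v₁ (2 * Real.pi) (2 * Real.pi) - v₁ (t - b₂) b₂ ≥ Real.pi - 1 := by
  have h4 : Real.sin (2 * Real.pi + 2 * Real.pi) = 0 := by
    rw [Real.sin_add_two_pi, Real.sin_two_pi]
  simp only [v₁, v₂, sub_add_cancel, Real.sin_add_pi, ht, h4]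
  constructor <;> linarith

theorem stmt_2 :
    ∀ b₂ ∈ Set.Icc (0 : ℝ) (2 * Real.pi), ∃ b₁ ∈ Set.Icc (0 : ℝ) (2 * Real.pi),
      v₁ b₁ b₂ > v₂ b₁ b₂ ∧
      v₁ (2 * Real.pi) (2 * Real.pi) - v₁ b₁ b₂ ≥ Real.pi - 1 := by
  rintro b₂ ⟨h0, h1⟩
  have hpi := Real.pi_pos
  rcases le_total b₂ (Real.pi / 2) with h | h
  · refine ⟨Real.pi / 2 - b₂, ⟨by linarith, by linarith⟩, ?_⟩
    exact deviation_of_sin_eq_one Real.sin_pi_div_two (by linarith)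
  · refine ⟨Real.pi / 2 + 2 * Real.pi - b₂, ⟨by linarith, by linarith⟩, ?_⟩
    exact deviation_of_sin_eq_one (by rw [Real.sin_add_two_pi, Real.sin_pi_div_two]) (by linarith)
end

section
/- Fix n ≥ 3 and ε > 0, and define valuations v₁,…,vₙ : (ℝ≥0)ⁿ → ℝ by v₁(s) = (Σ_{i=1}^{n} s_i) + ε, v₂(s) = 2(s₂ + ε), and v_i(s) = s_i for every 3 ≤ i ≤ n. Then this valuation profile satisfies single-crossing: for every pair of bidders i, i' ∈ {1,…,n}, every s ∈ (ℝ≥0)ⁿ, and every δ ≥ 0, v_i(s + δ·e_i) − v_i(s) ≥ v_{i'}(s + δ·e_i) − v_{i'}(s), where e_i is the i-th standard basis vector. -/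
/-- The valuation profile of the `Ω(n)` lower-bound construction:
`v₁(s) = (∑ i, s i) + ε`, `v₂(s) = 2(s₂ + ε)`, and `vᵢ(s) = sᵢ` for `i ≥ 3`.
Bidder `i ∈ {1,…,n}` is represented by the index `i - 1 : Fin n`. -/
noncomputable def val (n : ℕ) (ε : ℝ) (i : Fin n) (s : Fin n → ℝ) : ℝ :=
  if i.val = 0 then (∑ j, s j) + ε
  else if i.val = 1 then 2 * (s i + ε)
  else s i

theorem sum_update_add {n : ℕ} (s : Fin n → ℝ) (i : Fin n) (δ : ℝ) :
    ∑ j, Function.update s i (s i + δ) j = (∑ j, s j) + δ := by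
  have h := Finset.sum_update_of_mem (Finset.mem_univ i) s (s i)
  rw [Function.update_eq_self] at h
  rw [Finset.sum_update_of_mem (Finset.mem_univ i), h]
  ring

theorem stmt_3 (n : ℕ) (hn : 3 ≤ n) (ε : ℝ) (hε : 0 < ε)
    (i i' : Fin n) (s : Fin n → ℝ) (hs : ∀ j, 0 ≤ s j) (δ : ℝ) (hδ : 0 ≤ δ) :
    val n ε i (Function.update s i (s i + δ)) - val n ε i s ≥
      val n ε i' (Function.update s i (s i + δ)) - val n ε i' s := by
  unfold val
  rw [sum_update_add]
  by_cases h : i' = i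
  · rw [h]
  · rw [Function.update_self, Function.update_of_ne h]
    split_ifs <;> linarith
end

section
/- Let n ≥ 2 and let X be a random variable distributed Binomial(n, 1/n) (the number of successes in n independent Bernoulli trials each with success probability 1/n). Then for every integer k with 1 ≤ k ≤ n, P[X ≥ k] ≥ 1/(4·k^k). -/
/-- `P[X ≥ k]` for `X ~ Binomial(n, p)`:  `∑_{j=k}^{n} C(n,j) pʲ (1-p)^{n-j}`. -/
noncomputable def binomialTail (n : ℕ) (p : ℝ) (k : ℕ) : ℝ :=
  ∑ j ∈ Finset.Icc k n, (n.choose j : ℝ) * p ^ j * (1 - p) ^ (n - j)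

theorem Nat.pow_le_pow_self_mul_choose {n k : ℕ} (h : k ≤ n) : n ^ k ≤ k ^ k * n.choose k := by
  induction k generalizing n with
  | zero => simp
  | succ k ih =>
    obtain ⟨n, rfl⟩ : ∃ m, n = m + 1 := ⟨n - 1, by omega⟩
    have hkn : k ≤ n := by omega
    have hbase : (n + 1) ^ k ≤ (k + 1) ^ k * n.choose k := by
      refine le_of_mul_le_mul_left (a := k ^ k) ?_ Nat.pow_self_pos
      calc k ^ k * (n + 1) ^ k = (k * (n + 1)) ^ k := (mul_pow _ _ _).symm
        _ ≤ ((k + 1) * n) ^ k := Nat.pow_le_pow_left (by nlinarith) k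
        _ = (k + 1) ^ k * n ^ k := mul_pow _ _ _
        _ ≤ (k + 1) ^ k * (k ^ k * n.choose k) := Nat.mul_le_mul_left _ (ih hkn)
        _ = k ^ k * ((k + 1) ^ k * n.choose k) := by ring
    calc (n + 1) ^ (k + 1) = (n + 1) ^ k * (n + 1) := pow_succ _ _
      _ ≤ (k + 1) ^ k * n.choose k * (n + 1) := Nat.mul_le_mul_right _ hbase
      _ = (k + 1) ^ k * ((n + 1) * n.choose k) := by ring
      _ = (k + 1) ^ (k + 1) * (n + 1).choose (k + 1) := by
        rw [Nat.add_one_mul_choose_eq]; ring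

theorem one_fourth_le_one_sub_inv_pow {m : ℕ} (hm : 1 ≤ m) :
    (1 / 4 : ℝ) ≤ (1 - 1 / ((m + 1 : ℕ) : ℝ)) ^ m := by
  have hm0 : (0 : ℝ) < m := by exact_mod_cast hm
  have hinv : 1 - 1 / ((m + 1 : ℕ) : ℝ) = (1 + 1 / (m : ℝ))⁻¹ := by
    push_cast
    field_simp
    ring
  have hexp : (1 + 1 / (m : ℝ)) ^ m ≤ 4 := by
    calc (1 + 1 / (m : ℝ)) ^ m ≤ Real.exp (1 / m) ^ m := by
          gcongr
          linarith [Real.add_one_le_exp (1 / (m : ℝ))]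
      _ = Real.exp 1 := by
          rw [← Real.exp_nat_mul, mul_one_div_cancel hm0.ne']
      _ ≤ 4 := by linarith [Real.exp_one_lt_d9]
  rw [hinv, inv_pow, one_div]
  gcongr

theorem stmt_7 (n : ℕ) (hn : 2 ≤ n) (k : ℕ) (hk1 : 1 ≤ k) (hkn : k ≤ n) :
    binomialTail n (1 / n) k ≥ 1 / (4 * (k : ℝ) ^ k) := by
  have hn0 : (0 : ℝ) < n := by exact_mod_cast (by omega : 0 < n)
  have hk0 : (0 : ℝ) < k := by exact_mod_cast hk1
  have hp0 : (0 : ℝ) ≤ 1 - 1 / n := by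
    rw [sub_nonneg, div_le_one hn0]
    exact_mod_cast (by omega : 1 ≤ n)
  have hp1 : (1 : ℝ) - 1 / n ≤ 1 := by
    linarith [one_div_pos.mpr hn0]
  have hquarter : (1 / 4 : ℝ) ≤ (1 - 1 / (n : ℝ)) ^ (n - k) := by
    have h := one_fourth_le_one_sub_inv_pow (m := n - 1) (by omega)
    rw [Nat.sub_add_cancel (by omega : 1 ≤ n)] at h
    exact h.trans (pow_le_pow_of_le_one hp0 hp1 (by omega))
  have hchoose : 1 / (k : ℝ) ^ k ≤ (n.choose k : ℝ) * (1 / n) ^ k := by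
    rw [one_div_pow, mul_one_div, div_le_div_iff₀ (by positivity) (by positivity), one_mul,
      mul_comm]
    exact_mod_cast Nat.pow_le_pow_self_mul_choose hkn
  calc 1 / (4 * (k : ℝ) ^ k) = 1 / (k : ℝ) ^ k * (1 / 4) := by
        field_simp
    _ ≤ (n.choose k : ℝ) * (1 / n) ^ k * (1 - 1 / n) ^ (n - k) := by
        gcongr
    _ ≤ binomialTail n (1 / n) k :=
        Finset.single_le_sum
          (f := fun j => (n.choose j : ℝ) * (1 / (n : ℝ)) ^ j * (1 - 1 / (n : ℝ)) ^ (n - j))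
          (fun j _ => by positivity) (Finset.left_mem_Icc.mpr hkn)
end
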